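/- Let N > 1 be a positive integer and H a finite group such that: (1) H contains no subgroup of index dividing N other than H itself; and (2) for every factorization N = ab with integers a > 1 and b > 1, it is not the case that there exist both an absolutely simple F₂[H]-module of F₂-dimension a and an absolutely simple F₂[H]-module of F₂-dimension b. Then every absolutely simple F₂[H]-module of F₂-dimension N is very simple. -/

import Mathlib

/-- A representation `ρ : G → Aut_F(V)` is *very simple* if every `F`-subalgebra
`R ⊆ End_F(V)` (containing `Id`) that is stable under conjugation by all `ρ(σ)`
is either `F·Id` or all of `End_F(V)`. -/
def VerySimple {F G V : Type*} [Field F] [Group G]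
    [AddCommGroup V] [Module F V] (ρ : Representation F G V) : Prop :=
  ∀ R : Subalgebra F (Module.End F V),
    (∀ σ : G, ∀ r ∈ R, ρ σ * r * ρ σ⁻¹ ∈ R) → R = ⊥ ∨ R = ⊤

/-- There exists an absolutely simple `F₂[H]`-module of `F₂`-dimension `d`. -/
def ExistsAbsSimpleF2ModOfDim (H : Type*) [Group H] (d : ℕ) : Prop :=
  ∃ ρ : Representation (ZMod 2) H (Fin d → ZMod 2),
    Algebra.adjoin (ZMod 2) (Set.range ρ) = ⊤


section aux

universe u

variable {H : Type*} [Group H] {V : Type u} [AddCommGroup V] [Module (ZMod 2) V]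
  (ρ : Representation (ZMod 2) H V)

theorem aux_zmod (r : ZMod 2) : r = 0 ∨ r = 1 := by decide +revert

theorem aux_irred (habs : Algebra.adjoin (ZMod 2) (Set.range ρ) = ⊤)
    (W : Submodule (ZMod 2) V) (hW : ∀ h, ∀ w ∈ W, ρ h w ∈ W) : W = ⊥ ∨ W = ⊤ := by
  have hall : ∀ f : Module.End (ZMod 2) V, ∀ w ∈ W, f w ∈ W := by
    intro f
    have hf : f ∈ Algebra.adjoin (ZMod 2) (Set.range ρ) := by rw [habs]; trivial
    induction hf using Algebra.adjoin_induction with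
    | mem x hx => obtain ⟨h, rfl⟩ := hx; exact hW h
    | algebraMap r => intro w hw; simpa using W.smul_mem r hw
    | add x y _ _ hx hy => intro w hw; exact W.add_mem (hx w hw) (hy w hw)
    | mul x y _ _ hx hy => intro w hw; exact hx _ (hy w hw)
  by_cases h : W = ⊥
  · exact Or.inl h
  · right
    obtain ⟨w, hw, hw0⟩ := W.ne_bot_iff.mp h
    obtain ⟨f, hf⟩ : ∃ f : Module.Dual (ZMod 2) V, f w ≠ 0 := by
      by_contra! hc
      exact hw0 ((Module.forall_dual_apply_eq_zero_iff (ZMod 2) w).mp hc)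
    rw [eq_top_iff]
    intro v _
    have := W.smul_mem (f w)⁻¹ (hall (f.smulRight v) w hw)
    simpa [smul_smul, inv_mul_cancel₀ hf] using this

theorem aux_schur (habs : Algebra.adjoin (ZMod 2) (Set.range ρ) = ⊤)
    (z : Module.End (ZMod 2) V) (hz : ∀ h, ρ h * z = z * ρ h) :
    ∃ r : ZMod 2, z = algebraMap _ _ r := by
  have hall : ∀ f : Module.End (ZMod 2) V, f * z = z * f := by
    intro f
    have hf : f ∈ Algebra.adjoin (ZMod 2) (Set.range ρ) := by rw [habs]; trivial
    induction hf using Algebra.adjoin_induction with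
    | mem x hx => obtain ⟨h, rfl⟩ := hx; exact hz h
    | algebraMap r => exact Algebra.commutes _ _
    | add x y _ _ hx hy => rw [add_mul, mul_add, hx, hy]
    | mul x y _ _ hx hy => rw [mul_assoc, hy, ← mul_assoc, hx, mul_assoc]
  have : z ∈ Subalgebra.center (ZMod 2) (Module.End (ZMod 2) V) :=
    Subalgebra.mem_center_iff.mpr hall
  rw [Algebra.IsCentral.center_eq_bot, Algebra.mem_bot] at this
  obtain ⟨r, hr⟩ := this
  exact ⟨r, hr.symm⟩

theorem aux_inv_mul (h : H) : ρ h⁻¹ * ρ h = 1 := by rw [← map_mul]; simp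
theorem aux_mul_inv (h : H) : ρ h * ρ h⁻¹ = 1 := by rw [← map_mul]; simp

/-- conjugation by `ρ h` as an automorphism of a stable subalgebra. -/
def auxConj (R : Subalgebra (ZMod 2) (Module.End (ZMod 2) V))
    (hR : ∀ σ : H, ∀ r ∈ R, ρ σ * r * ρ σ⁻¹ ∈ R) : H →* (R ≃ₐ[ZMod 2] R) where
  toFun h :=
    { toFun := fun r => ⟨ρ h * r * ρ h⁻¹, hR h r r.2⟩
      invFun := fun r => ⟨ρ h⁻¹ * r * ρ h, by simpa using hR h⁻¹ r r.2⟩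
      left_inv := fun r => by
        ext1
        calc ρ h⁻¹ * (ρ h * r * ρ h⁻¹) * ρ h = (ρ h⁻¹ * ρ h) * r * (ρ h⁻¹ * ρ h) := by
              simp only [mul_assoc]
          _ = r := by rw [aux_inv_mul]; simp
      right_inv := fun r => by
        ext1
        calc ρ h * (ρ h⁻¹ * r * ρ h) * ρ h⁻¹ = (ρ h * ρ h⁻¹) * r * (ρ h * ρ h⁻¹) := by
              simp only [mul_assoc]
          _ = r := by rw [aux_mul_inv]; simp
      map_mul' := fun r s => by
        ext1
        calc ρ h * (r * s) * ρ h⁻¹ = ρ h * r * 1 * (s * ρ h⁻¹) := by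
              simp only [mul_assoc, one_mul]
          _ = (ρ h * r * ρ h⁻¹) * (ρ h * s * ρ h⁻¹) := by
              rw [← aux_inv_mul ρ h]; simp only [mul_assoc]
      map_add' := fun r s => by
        ext1
        simp [mul_add, add_mul]
      commutes' := fun r => by
        ext1
        calc ρ h * (algebraMap _ _ r) * ρ h⁻¹ = algebraMap _ _ r * (ρ h * ρ h⁻¹) := by
              rw [← mul_assoc, Algebra.commutes]
          _ = algebraMap _ _ r := by rw [aux_mul_inv, mul_one] }
  map_one' := by ext1 r; ext1; simp
  map_mul' g h := by
    ext1 r; ext1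
    simp [mul_assoc]

theorem auxConj_apply (R : Subalgebra (ZMod 2) (Module.End (ZMod 2) V))
    (hR : ∀ σ : H, ∀ r ∈ R, ρ σ * r * ρ σ⁻¹ ∈ R) (h : H) (r : R) :
    (auxConj ρ R hR h r : Module.End (ZMod 2) V) = ρ h * r * ρ h⁻¹ := rfl

theorem auxConj_mul (R : Subalgebra (ZMod 2) (Module.End (ZMod 2) V))
    (hR : ∀ σ : H, ∀ r ∈ R, ρ σ * r * ρ σ⁻¹ ∈ R) (h : H) (r : R) :
    (auxConj ρ R hR h r : Module.End (ZMod 2) V) * ρ h = ρ h * r := by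
  rw [auxConj_apply, mul_assoc, aux_inv_mul, mul_one]

theorem aux_semisimple [Finite V] [Nontrivial V]
    (habs : Algebra.adjoin (ZMod 2) (Set.range ρ) = ⊤)
    (R : Subalgebra (ZMod 2) (Module.End (ZMod 2) V))
    (hR : ∀ σ : H, ∀ r ∈ R, ρ σ * r * ρ σ⁻¹ ∈ R) : IsSemisimpleRing R := by
  have : Finite (Module.End (ZMod 2) V) := DFunLike.finite _
  have : Finite R := inferInstance
  have : IsArtinianRing R := inferInstance
  rw [IsArtinianRing.isSemisimpleRing_iff_jacobson]
  set J := Ring.jacobson R with hJ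
  have hconj : ∀ h, ∀ r ∈ J, auxConj ρ R hR h r ∈ J := by
    intro h r hr
    let f : R →+* R := ((auxConj ρ R hR h : R ≃ₐ[ZMod 2] R) : R →+* R)
    have : RingHomSurjective f := ⟨(auxConj ρ R hR h).surjective⟩
    exact Ring.le_comap_jacobson f hr
  let W : Submodule (ZMod 2) V := Submodule.span _ {v | ∃ r ∈ J, ∃ w, v = (r : Module.End (ZMod 2) V) w}
  have hW : ∀ h, ∀ w ∈ W, ρ h w ∈ W := by
    intro h w hw
    induction hw using Submodule.span_induction with
    | mem x hx =>
      obtain ⟨r, hr, w, rfl⟩ := hx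
      refine Submodule.subset_span ⟨_, hconj h r hr, ρ h w, ?_⟩
      exact (LinearMap.congr_fun (auxConj_mul ρ R hR h r) w).symm
    | zero => simp
    | add x y _ _ hx hy => rw [map_add]; exact W.add_mem hx hy
    | smul a x _ hx => rw [map_smul]; exact W.smul_mem a hx
  rcases aux_irred ρ habs W hW with h | h
  · rw [eq_bot_iff]
    intro r hr
    rw [Submodule.mem_bot]
    ext1
    ext v
    have : (r : Module.End (ZMod 2) V) v ∈ W := Submodule.subset_span ⟨r, hr, v, rfl⟩
    rw [h, Submodule.mem_bot] at this
    simpa using this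
  · exfalso
    have hlt := Submodule.jacobson_smul_lt_top (R := R) (M := V) ⊤
    apply hlt.ne
    rw [eq_top_iff]
    intro v _
    have hv : v ∈ W := by rw [h]; trivial
    induction hv using Submodule.span_induction with
    | mem x hx =>
      obtain ⟨s, hs, w, rfl⟩ := hx
      exact Submodule.smul_mem_smul hs (Submodule.mem_top (x := w))
    | zero => exact Submodule.zero_mem _
    | add x y _ _ hx hy => exact Submodule.add_mem _ (hx trivial) (hy trivial)
    | smul a x _ hx => exact Submodule.smul_of_tower_mem _ a (hx trivial)

theorem aux_dim {ι : Type*} [Fintype ι] [Finite V] (f : ι → Module.End (ZMod 2) V) (m : ℕ)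
    (hid : ∀ i, f i * f i = f i) (horth : ∀ i j, i ≠ j → f i * f j = 0)
    (hsum : ∑ i, f i = 1) (hm : ∀ i, Module.finrank (ZMod 2) (LinearMap.range (f i)) = m) :
    Module.finrank (ZMod 2) V = Fintype.card ι * m := by
  classical
  let e : V ≃ₗ[ZMod 2] (∀ i, LinearMap.range (f i)) :=
    { LinearMap.pi (fun i => (f i).rangeRestrict) with
      invFun := fun w => ∑ i, (w i : V)
      left_inv := fun v => by
        have := LinearMap.congr_fun hsum v
        simpa [LinearMap.sum_apply] using this
      right_inv := fun w => by
        ext i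
        have hw : ∀ j, f i (w j : V) = if j = i then (w j : V) else 0 := by
          intro j
          obtain ⟨x, hx⟩ := (w j).2
          rw [← hx]
          split_ifs with h
          · subst h; exact LinearMap.congr_fun (hid j) x
          · exact LinearMap.congr_fun (horth i j (Ne.symm h)) x
        simp [map_sum, hw] }
  rw [e.finrank_eq, Module.finrank_pi_fintype]
  simp [hm]

theorem aux_idem [Finite V] {N : ℕ} (hsub : ∀ K : Subgroup H, K.index ∣ N → K = ⊤)
    (hdim : Module.finrank (ZMod 2) V = N)
    (habs : Algebra.adjoin (ZMod 2) (Set.range ρ) = ⊤)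
    (R : Subalgebra (ZMod 2) (Module.End (ZMod 2) V))
    (hR : ∀ σ : H, ∀ r ∈ R, ρ σ * r * ρ σ⁻¹ ∈ R)
    (e₀ : Module.End (ZMod 2) V) (he₀ : e₀ ∈ R) (hi₀ : e₀ * e₀ = e₀)
    (hc₀ : ∀ r ∈ R, e₀ * r = r * e₀) (hne₀ : e₀ ≠ 0) : e₀ = 1 := by
  classical
  have : Finite (Module.End (ZMod 2) V) := DFunLike.finite _
  let P : Module.End (ZMod 2) V → Prop := fun e =>
    e ∈ R ∧ e * e = e ∧ (∀ r ∈ R, e * r = r * e) ∧ e ≠ 0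
  let d : Module.End (ZMod 2) V → ℕ := fun e => Module.finrank (ZMod 2) (LinearMap.range e)
  have hP₀ : P e₀ := ⟨he₀, hi₀, hc₀, hne₀⟩
  obtain ⟨e, hPe, hmin⟩ : ∃ e, P e ∧ ∀ f, P f → d e ≤ d f := by
    have hne : {e | P e}.Nonempty := ⟨e₀, hP₀⟩
    exact ⟨Function.argminOn d {e | P e} hne, Function.argminOn_mem d _ hne,
      fun f hf => Function.argminOn_le d _ hf⟩
  have hhalf : ∀ f g, P f → P g → d f = d e → f * g ≠ 0 → g * f = f := by
    intro f g hf hg hd hfg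
    have hcomm : f * g = g * f := hf.2.2.1 g hg.1
    have hPfg : P (f * g) := by
      refine ⟨R.mul_mem hf.1 hg.1, ?_, ?_, hfg⟩
      · calc f * g * (f * g) = f * (g * f) * g := by simp only [mul_assoc]
          _ = f * (f * g) * g := by rw [hcomm]
          _ = (f * f) * (g * g) := by simp only [mul_assoc]
          _ = f * g := by rw [hf.2.1, hg.2.1]
      · intro r hr
        rw [mul_assoc, hg.2.2.1 r hr, ← mul_assoc, hf.2.2.1 r hr, mul_assoc]
    have hle : LinearMap.range (f * g) ≤ LinearMap.range f := LinearMap.range_comp_le_range g f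
    have heq : LinearMap.range (f * g) = LinearMap.range f := by
      apply Submodule.eq_of_le_of_finrank_le hle
      have := hmin _ hPfg
      rw [← hd] at this
      exact this
    ext v
    have hv : f v ∈ LinearMap.range (f * g) := by rw [heq]; exact ⟨v, rfl⟩
    obtain ⟨w, hw⟩ := hv
    rw [hcomm] at hw
    change g (f v) = f v
    rw [← hw]
    change g (g (f w)) = g (f w)
    exact LinearMap.congr_fun hg.2.1 (f w)
  have hfull : ∀ f g, P f → P g → d f = d e → d g = d e → f ≠ g → f * g = 0 := by
    intro f g hf hg hdf hdg hne
    by_contra h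
    have h1 := hhalf f g hf hg hdf h
    have hcomm : f * g = g * f := hf.2.2.1 g hg.1
    have h2 := hhalf g f hg hf hdg (by rwa [← hcomm])
    exact hne (by rw [← h1, ← hcomm, h2])
  let act : MulAction H (Module.End (ZMod 2) V) :=
    { smul := fun h f => ρ h * f * ρ h⁻¹
      one_smul := fun f => by change ρ 1 * f * ρ 1⁻¹ = f; simp
      mul_smul := fun g h f => by
        change ρ (g * h) * f * ρ (g * h)⁻¹ = ρ g * (ρ h * f * ρ h⁻¹) * ρ g⁻¹
        simp [mul_assoc] }
  have hsmul : ∀ (h : H) f, h • f = ρ h * f * ρ h⁻¹ := fun _ _ => rfl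
  have hPc : ∀ (h : H) f, P f → P (h • f) := by
    intro h f hf
    have hc : ∀ g : R, ((auxConj ρ R hR h g : R) : Module.End (ZMod 2) V) = h • (g : Module.End (ZMod 2) V) := fun _ => rfl
    have h1 := hc ⟨f, hf.1⟩
    simp only at h1
    rw [← h1]
    refine ⟨Subtype.property _, ?_, ?_, ?_⟩
    · rw [← Subalgebra.coe_mul, ← map_mul]
      congr 2
      exact Subtype.ext hf.2.1
    · intro r hr
      obtain ⟨s, hs⟩ := (auxConj ρ R hR h).surjective ⟨r, hr⟩
      have : r = (auxConj ρ R hR h s : R) := by rw [hs]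
      rw [this, ← Subalgebra.coe_mul, ← Subalgebra.coe_mul, ← map_mul, ← map_mul]
      congr 2
      exact Subtype.ext (hf.2.2.1 s s.2)
    · intro h0
      have h2 : auxConj ρ R hR h ⟨f, hf.1⟩ = 0 := Subtype.ext h0
      rw [EmbeddingLike.map_eq_zero_iff] at h2
      exact hf.2.2.2 (congrArg Subtype.val h2)
  have hdc : ∀ (h : H), d (h • e) = d e := by
    intro h
    refine le_antisymm ?_ (hmin _ (hPc h e hPe))
    have h1 : d (ρ h * e * ρ h⁻¹) ≤ d (ρ h * e) :=
      Submodule.finrank_mono (LinearMap.range_comp_le_range (ρ h⁻¹) (ρ h * e))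
    have h2 : d (ρ h * e) ≤ d e := by
      have : LinearMap.range (ρ h * e) = (LinearMap.range e).map (ρ h) :=
        LinearMap.range_comp e (ρ h)
      change Module.finrank (ZMod 2) (LinearMap.range (ρ h * e)) ≤ _
      rw [this]
      exact Submodule.finrank_map_le _ _
    exact h1.trans h2
  let X := MulAction.orbit H e
  let : Fintype X := Fintype.ofFinite X
  have hX : ∀ x : X, P x.1 ∧ d x.1 = d e := by
    rintro ⟨_, h, rfl⟩
    exact ⟨hPc h e hPe, hdc h⟩
  have horth : ∀ x y : X, x ≠ y → (x.1 * y.1) = 0 := fun x y hxy =>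
    hfull _ _ (hX x).1 (hX y).1 (hX x).2 (hX y).2 (fun h => hxy (Subtype.ext h))
  let s : Module.End (ZMod 2) V := ∑ x : X, x.1
  have hs : ∀ h, ρ h * s * ρ h⁻¹ = s := by
    intro h
    simp only [s, Finset.mul_sum, Finset.sum_mul]
    exact Equiv.sum_comp (MulAction.toPerm h : Equiv.Perm X) (fun x => x.1)
  have hs1 : s = 1 := by
    obtain ⟨r, hr⟩ := aux_schur ρ habs s (fun h => by
      conv_rhs => rw [← hs h]
      rw [mul_assoc, mul_assoc, aux_inv_mul, mul_one])
    have hse : s * e = e := by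
      simp only [s, Finset.sum_mul]
      rw [Finset.sum_eq_single (⟨e, MulAction.mem_orbit_self e⟩ : X)]
      · exact hPe.2.1
      · intro x _ hx
        exact horth x ⟨e, MulAction.mem_orbit_self e⟩ hx
      · simp
    have hr01 : r = 0 ∨ r = 1 := aux_zmod r
    rcases hr01 with rfl | rfl
    · rw [hr, map_zero, zero_mul] at hse
      exact absurd hse.symm hPe.2.2.2
    · rw [hr, map_one]
  have hcard := aux_dim (fun x : X => x.1) (d e) (fun x => (hX x).1.2.1) horth hs1
    (fun x => (hX x).2)
  have hstab : MulAction.stabilizer H e = ⊤ := by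
    apply hsub
    rw [MulAction.index_stabilizer, ← hdim, hcard, ← Nat.card_eq_fintype_card]
    exact Dvd.intro _ rfl
  have hfix : ∀ h : H, h • e = e := by
    intro h
    have : h ∈ MulAction.stabilizer H e := by rw [hstab]; trivial
    exact this
  have hsub1 : ∀ x : X, x.1 = e := by
    rintro ⟨_, h, rfl⟩
    exact hfix h
  have : Unique X := ⟨⟨⟨e, MulAction.mem_orbit_self e⟩⟩, fun x => Subtype.ext (hsub1 x)⟩
  have he1 : e = 1 := by
    rw [← hs1]
    change e = ∑ x : X, x.1
    rw [Fintype.sum_unique]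
    exact (hsub1 _).symm
  have hd0 := hmin e₀ hP₀
  have htop : LinearMap.range e₀ = ⊤ := by
    apply Submodule.eq_top_of_finrank_eq
    apply le_antisymm (Submodule.finrank_le _)
    refine le_trans ?_ hd0
    change _ ≤ Module.finrank (ZMod 2) (LinearMap.range e)
    rw [he1]
    have : LinearMap.range (1 : Module.End (ZMod 2) V) = ⊤ := LinearMap.range_id
    rw [this, finrank_top]
  ext v
  have hv : v ∈ LinearMap.range e₀ := by rw [htop]; trivial
  obtain ⟨w, rfl⟩ := hv
  exact LinearMap.congr_fun hi₀ w

theorem aux_field {Z : Type*} [Ring Z] [Finite Z] [Algebra (ZMod 2) Z] (hZ : IsField Z)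
    [Finite V] [Module Z V] [IsScalarTower (ZMod 2) Z V] :
    Nat.card (Z ≃ₐ[ZMod 2] Z) ∣ Module.finrank (ZMod 2) V := by
  let F : Field Z := hZ.toField
  have h1 : Nat.card (Z ≃ₐ[ZMod 2] Z) = Module.finrank (ZMod 2) Z :=
    IsGalois.card_aut_eq_finrank (ZMod 2) Z
  rw [h1]
  exact ⟨_, (Module.finrank_mul_finrank (ZMod 2) Z V).symm⟩

theorem aux_matrixD [Finite V] [Nontrivial V] {N : ℕ}
    (hsub : ∀ K : Subgroup H, K.index ∣ N → K = ⊤)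
    (hdim : Module.finrank (ZMod 2) V = N)
    (habs : Algebra.adjoin (ZMod 2) (Set.range ρ) = ⊤)
    (R : Subalgebra (ZMod 2) (Module.End (ZMod 2) V))
    (hR : ∀ σ : H, ∀ r ∈ R, ρ σ * r * ρ σ⁻¹ ∈ R) :
    ∃ (a : ℕ) (_ : NeZero a) (D : Type u) (_ : DivisionRing D) (_ : Algebra (ZMod 2) D)
      (_ : Finite D), Nonempty (R ≃ₐ[ZMod 2] Matrix (Fin a) (Fin a) D) := by
  classical
  have : Finite (Module.End (ZMod 2) V) := DFunLike.finite _
  have : IsSemisimpleRing R := aux_semisimple ρ habs R hR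
  obtain ⟨n, D, d, _, _, hfin, hd, ⟨φ⟩⟩ :=
    IsSemisimpleRing.exists_algEquiv_pi_matrix_divisionRing_finite (ZMod 2) R
  have hn : Nonempty (Fin n) := by
    by_contra hc
    rw [not_nonempty_iff] at hc
    have : (1 : R) = 0 := φ.injective (Subsingleton.elim _ _)
    exact one_ne_zero this
  obtain ⟨i⟩ := hn
  let e : R := φ.symm (Pi.single i 1)
  have he : e = 1 := by
    have := aux_idem ρ hsub hdim habs R hR e e.2 ?_ ?_ ?_
    · exact Subtype.ext this
    · rw [← Subalgebra.coe_mul]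
      congr 1
      rw [← map_mul, ← Pi.single_mul, one_mul]
    · intro r hr
      have : e * ⟨r, hr⟩ = ⟨r, hr⟩ * e := by
        apply φ.injective
        rw [map_mul, map_mul, AlgEquiv.apply_symm_apply]
        ext1 j
        by_cases hj : j = i
        · subst hj; simp
        · simp [Pi.single_eq_of_ne hj]
      exact congrArg Subtype.val this
    · intro h0
      have h1 : e = 0 := Subtype.ext h0
      rw [EmbeddingLike.map_eq_zero_iff] at h1
      have := congrFun h1 i
      simp at this
  have huniq : ∀ j, j = i := by
    intro j
    by_contra hj
    have h1 : φ e = 1 := by rw [he, map_one]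
    rw [AlgEquiv.apply_symm_apply] at h1
    have := congrFun h1 j
    rw [Pi.single_eq_of_ne hj] at this
    exact zero_ne_one this
  refine ⟨d i, hd i, D i, inferInstance, inferInstance,
    Module.finite_of_finite (ZMod 2), ⟨φ.trans ?_⟩⟩
  refine AlgEquiv.ofBijective (Pi.evalAlgHom (ZMod 2) _ i) ⟨?_, ?_⟩
  · intro x y hxy
    ext1 j
    rw [huniq j]
    exact hxy
  · intro x
    exact ⟨Pi.single i x, by simp⟩

theorem aux_struct [Finite V] [Nontrivial V] {N : ℕ}
    (hsub : ∀ K : Subgroup H, K.index ∣ N → K = ⊤)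
    (hdim : Module.finrank (ZMod 2) V = N)
    (habs : Algebra.adjoin (ZMod 2) (Set.range ρ) = ⊤)
    (R : Subalgebra (ZMod 2) (Module.End (ZMod 2) V))
    (hR : ∀ σ : H, ∀ r ∈ R, ρ σ * r * ρ σ⁻¹ ∈ R) :
    ∃ (a : ℕ), Nonempty (R ≃ₐ[ZMod 2] Matrix (Fin a) (Fin a) (ZMod 2)) := by
  classical
  have : Finite (Module.End (ZMod 2) V) := DFunLike.finite _
  obtain ⟨a, _, D, _, _, _, ⟨φ⟩⟩ := aux_matrixD ρ hsub hdim habs R hR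
  have hsimple : IsSimpleRing R :=
    IsSimpleRing.of_ringEquiv φ.symm.toRingEquiv inferInstance
  let Z : Subalgebra (ZMod 2) (Module.End (ZMod 2) V) :=
    R ⊓ Subalgebra.centralizer (ZMod 2) (R : Set (Module.End (ZMod 2) V))
  have hZ : ∀ σ : H, ∀ r ∈ Z, ρ σ * r * ρ σ⁻¹ ∈ Z := by
    intro σ z hz
    refine ⟨hR σ z hz.1, ?_⟩
    rw [SetLike.mem_coe, Subalgebra.mem_centralizer_iff]
    intro r hr
    obtain ⟨s, hs⟩ := (auxConj ρ R hR σ).surjective ⟨r, hr⟩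
    have h1 : r = (auxConj ρ R hR σ s : R) := by rw [hs]
    have h2 : ρ σ * z * ρ σ⁻¹ = (auxConj ρ R hR σ ⟨z, hz.1⟩ : R) := rfl
    rw [h1, h2, ← Subalgebra.coe_mul, ← Subalgebra.coe_mul, ← map_mul, ← map_mul]
    congr 2
    exact Subtype.ext ((Subalgebra.mem_centralizer_iff (ZMod 2)).mp hz.2 s s.2)
  have hZf : IsField Z := by
    refine MulEquiv.isField (IsSimpleRing.isField_center R) (
      { toFun := fun z => ⟨⟨z, z.2.1⟩, ?_⟩
        invFun := fun z => ⟨z, z.1.2, ?_⟩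
        left_inv := fun _ => rfl
        right_inv := fun _ => rfl
        map_mul' := fun _ _ => rfl } : Z ≃* Subring.center R)
    · rw [Subring.mem_center_iff]
      intro g
      exact Subtype.ext ((Subalgebra.mem_centralizer_iff (ZMod 2)).mp z.2.2 g g.2)
    · rw [SetLike.mem_coe, Subalgebra.mem_centralizer_iff]
      intro g hg
      exact congrArg Subtype.val (Subring.mem_center_iff.mp z.2 ⟨g, hg⟩)
  have hcard : Nat.card (Z ≃ₐ[ZMod 2] Z) ∣ Module.finrank (ZMod 2) V := aux_field hZf
  have hker : (auxConj ρ Z hZ).ker = ⊤ := by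
    apply hsub
    rw [Subgroup.index_ker, ← hdim]
    exact (Subgroup.card_subgroup_dvd_card _).trans hcard
  have hscal : ∀ z ∈ Z, ∃ r : ZMod 2, z = algebraMap _ _ r := by
    intro z hz
    apply aux_schur ρ habs
    intro h
    have h1 : h ∈ (auxConj ρ Z hZ).ker := by rw [hker]; trivial
    rw [MonoidHom.mem_ker] at h1
    have h2 := auxConj_mul ρ Z hZ h ⟨z, hz⟩
    rw [h1] at h2
    exact h2.symm
  have hD : ∀ x y : D, x * y = y * x := by
    let F := littleWedderburn D
    exact fun x y => F.mul_comm x y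
  have hbij : Function.Bijective (Algebra.ofId (ZMod 2) D) := by
    refine ⟨(algebraMap (ZMod 2) D).injective, fun x => ?_⟩
    have hcomm : ∀ M : Matrix (Fin a) (Fin a) D,
        M * Matrix.diagonal (fun _ => x) = Matrix.diagonal (fun _ => x) * M := by
      intro M
      ext i j
      simp [hD]
    let y : R := φ.symm (Matrix.diagonal (fun _ => x))
    obtain ⟨r, hr⟩ := hscal y ⟨y.2, by
      rw [SetLike.mem_coe, Subalgebra.mem_centralizer_iff]
      intro g hg
      have : (⟨g, hg⟩ : R) * y = y * ⟨g, hg⟩ := by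
        apply φ.injective
        rw [map_mul, map_mul, AlgEquiv.apply_symm_apply, hcomm]
      exact congrArg Subtype.val this⟩
    have h1 : y = algebraMap (ZMod 2) R r := Subtype.ext hr
    have h2 : φ y = algebraMap _ _ r := by rw [h1, AlgEquiv.commutes]
    rw [AlgEquiv.apply_symm_apply] at h2
    refine ⟨r, ?_⟩
    have h3 := congrFun (congrFun h2 0) 0
    simp [Matrix.algebraMap_matrix_apply] at h3
    exact h3.symm
  let ψ : ZMod 2 ≃ₐ[ZMod 2] D := AlgEquiv.ofBijective _ hbij
  exact ⟨a, ⟨φ.trans ψ.symm.mapMatrix⟩⟩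

theorem aux_skolem {W : Type*} [AddCommGroup W] [Module (ZMod 2) W]
    (c : H →* (Module.End (ZMod 2) W ≃ₐ[ZMod 2] Module.End (ZMod 2) W)) :
    ∃ τ : Representation (ZMod 2) H W, ∀ h f, c h f * τ h = τ h * f := by
  have hT : ∀ h, ∃ T : W ≃ₗ[ZMod 2] W, c h = T.conjAlgEquiv (ZMod 2) :=
    fun h => (c h).eq_linearEquivConjAlgEquiv
  choose T hT using hT
  have huniq : ∀ S S' : W ≃ₗ[ZMod 2] W,
      S.conjAlgEquiv (ZMod 2) = S'.conjAlgEquiv (ZMod 2) → S = S' := by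
    intro S S' h
    rw [LinearEquiv.conjAlgEquiv_ext_iff'] at h
    obtain ⟨α, hα⟩ := h
    have : α = 1 := by
      rcases aux_zmod (α : ZMod 2) with h | h
      · exact absurd h α.ne_zero
      · exact Units.ext h
    rw [hα, this]; ext w; simp
  have hint : ∀ h f, c h f * (T h : Module.End (ZMod 2) W) = (T h : Module.End (ZMod 2) W) * f := by
    intro h f
    rw [hT h]
    ext w
    simp [LinearEquiv.conjAlgEquiv_apply]
  refine ⟨{ toFun := fun h => (T h : Module.End (ZMod 2) W), map_one' := ?_, map_mul' := ?_ }, hint⟩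
  · have : T 1 = LinearEquiv.refl _ _ := by
      apply huniq
      rw [← hT, map_one]
      ext f w
      simp [LinearEquiv.conjAlgEquiv_apply]
    rw [this]; rfl
  · intro g h
    have : T (g * h) = (T h).trans (T g) := by
      apply huniq
      rw [← hT, map_mul, hT, hT]
      ext f w
      simp [LinearEquiv.conjAlgEquiv_apply]
    rw [this]; rfl

open TensorProduct in
theorem aux_surj {X Y E : Type*} [Ring X] [Ring Y] [Ring E] [Algebra (ZMod 2) X]
    [Algebra (ZMod 2) Y] [Algebra (ZMod 2) E] [Module.Finite (ZMod 2) X]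
    [Module.Finite (ZMod 2) Y] (S : X ⊗[ZMod 2] Y →ₐ[ZMod 2] E) (hS : Function.Surjective S) :
    Module.finrank (ZMod 2) E ≤ Module.finrank (ZMod 2) X * Module.finrank (ZMod 2) Y := by
  have := LinearMap.finrank_le_finrank_of_surjective (f := S.toLinearMap) hS
  rwa [Module.finrank_tensorProduct] at this

open TensorProduct in
theorem aux_gen {X Y E ι : Type*} [Ring X] [Ring Y] [Ring E] [Algebra (ZMod 2) X]
    [Algebra (ZMod 2) Y] [Algebra (ZMod 2) E] [Module.Finite (ZMod 2) X]
    [Module.Finite (ZMod 2) Y] (T : X ⊗[ZMod 2] Y →ₐ[ZMod 2] E) (u : ι → X) (v : ι → Y)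
    (hT : Algebra.adjoin (ZMod 2) (Set.range (fun h => T (u h ⊗ₜ v h))) = ⊤) :
    Module.finrank (ZMod 2) E ≤
      Module.finrank (ZMod 2) (Algebra.adjoin (ZMod 2) (Set.range u)) *
      Module.finrank (ZMod 2) (Algebra.adjoin (ZMod 2) (Set.range v)) := by
  let A : Subalgebra (ZMod 2) X := Algebra.adjoin (ZMod 2) (Set.range u)
  let B : Subalgebra (ZMod 2) Y := Algebra.adjoin (ZMod 2) (Set.range v)
  let S : A ⊗[ZMod 2] B →ₐ[ZMod 2] E :=
    T.comp (Algebra.TensorProduct.map A.val B.val)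
  have hSsurj : Function.Surjective S := by
    rw [← AlgHom.range_eq_top, eq_top_iff, ← hT]
    apply Algebra.adjoin_le
    rintro _ ⟨h, rfl⟩
    exact ⟨(⟨u h, Algebra.subset_adjoin ⟨h, rfl⟩⟩ : A) ⊗ₜ
      (⟨v h, Algebra.subset_adjoin ⟨h, rfl⟩⟩ : B), rfl⟩
  exact aux_surj S hSsurj

set_option maxHeartbeats 1000000 in
open TensorProduct in
theorem aux_main [Finite V] [Nontrivial V] {N : ℕ}
    (hsub : ∀ K : Subgroup H, K.index ∣ N → K = ⊤)
    (hdim : Module.finrank (ZMod 2) V = N)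
    (habs : Algebra.adjoin (ZMod 2) (Set.range ρ) = ⊤)
    (R : Subalgebra (ZMod 2) (Module.End (ZMod 2) V))
    (hR : ∀ σ : H, ∀ r ∈ R, ρ σ * r * ρ σ⁻¹ ∈ R) :
    ∃ a b : ℕ, N = a * b ∧ Module.finrank (ZMod 2) R = a * a ∧
      ExistsAbsSimpleF2ModOfDim H a ∧ ExistsAbsSimpleF2ModOfDim H b := by
  classical
  let C : Subalgebra (ZMod 2) (Module.End (ZMod 2) V) :=
    Subalgebra.centralizer (ZMod 2) (R : Set (Module.End (ZMod 2) V))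
  have hC : ∀ σ : H, ∀ r ∈ C, ρ σ * r * ρ σ⁻¹ ∈ C := by
    intro σ z hz
    rw [Subalgebra.mem_centralizer_iff] at hz ⊢
    intro r hr
    have h1 := hz _ (hR σ⁻¹ r hr)
    rw [inv_inv] at h1
    calc r * (ρ σ * z * ρ σ⁻¹) = (ρ σ * ρ σ⁻¹) * r * (ρ σ * z * ρ σ⁻¹) := by
          rw [aux_mul_inv, one_mul]
      _ = ρ σ * (ρ σ⁻¹ * r * ρ σ * z) * ρ σ⁻¹ := by simp only [mul_assoc]
      _ = ρ σ * (z * (ρ σ⁻¹ * r * ρ σ)) * ρ σ⁻¹ := by rw [h1]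
      _ = (ρ σ * z * ρ σ⁻¹) * r * (ρ σ * ρ σ⁻¹) := by simp only [mul_assoc]
      _ = _ := by rw [aux_mul_inv, mul_one]
  obtain ⟨a, ⟨φ⟩⟩ := aux_struct ρ hsub hdim habs R hR
  obtain ⟨b, ⟨χ⟩⟩ := aux_struct ρ hsub hdim habs C hC
  have hra : Module.finrank (ZMod 2) R = a * a := by
    rw [φ.toLinearEquiv.finrank_eq, Module.finrank_matrix]; simp
  have hrb : Module.finrank (ZMod 2) C = b * b := by
    rw [χ.toLinearEquiv.finrank_eq, Module.finrank_matrix]; simp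
  have ha : a ≠ 0 := by
    rintro rfl
    have := Module.finrank_pos (R := ZMod 2) (M := R)
    omega
  have hb : b ≠ 0 := by
    rintro rfl
    have := Module.finrank_pos (R := ZMod 2) (M := C)
    omega
  have : NeZero a := ⟨ha⟩
  have : NeZero b := ⟨hb⟩
  have hcomm : ∀ (x : R) (y : C), Commute (R.val x) (C.val y) := fun x y =>
    (Subalgebra.mem_centralizer_iff (ZMod 2)).mp y.2 x x.2
  let T : R ⊗[ZMod 2] C →ₐ[ZMod 2] Module.End (ZMod 2) V :=
    Algebra.TensorProduct.lift R.val C.val hcomm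
  let T' : Matrix (Fin a × Fin b) (Fin a × Fin b) (ZMod 2) →ₐ[ZMod 2] Module.End (ZMod 2) V :=
    T.comp (((Algebra.TensorProduct.congr φ χ).trans
      (Matrix.kroneckerAlgEquiv (Fin a) (Fin b) (ZMod 2))).symm :
        Matrix (Fin a × Fin b) (Fin a × Fin b) (ZMod 2) →ₐ[ZMod 2] R ⊗[ZMod 2] C)
  have hTinj : Function.Injective T' := T'.toRingHom.injective
  have hle : (a * a) * (b * b) ≤ N * N := by
    have := LinearMap.finrank_le_finrank_of_injective (f := T'.toLinearMap) hTinj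
    rw [Module.finrank_matrix, Module.finrank_linearMap, hdim] at this
    simp only [Fintype.card_prod, Fintype.card_fin, Module.finrank_self, mul_one] at this
    rwa [mul_mul_mul_comm] at this
  -- Skolem-Noether
  let Φ : R ≃ₐ[ZMod 2] Module.End (ZMod 2) (Fin a → ZMod 2) := φ.trans Matrix.toLinAlgEquiv'
  let Χ : C ≃ₐ[ZMod 2] Module.End (ZMod 2) (Fin b → ZMod 2) := χ.trans Matrix.toLinAlgEquiv'
  let c : H →* (Module.End (ZMod 2) (Fin a → ZMod 2) ≃ₐ[ZMod 2]
      Module.End (ZMod 2) (Fin a → ZMod 2)) :=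
    { toFun := fun h => (Φ.symm.trans (auxConj ρ R hR h)).trans Φ
      map_one' := by ext1 f; simp
      map_mul' := fun g h => by ext1 f; simp }
  obtain ⟨τ, hτ⟩ := aux_skolem c
  let u : H →* R := (Φ.symm : _ →* R).comp τ
  have hu : ∀ h (r : R), auxConj ρ R hR h r * u h = u h * r := by
    intro h r
    apply Φ.injective
    have := hτ h (Φ r)
    simpa [u, c] using this
  have huu : ∀ h, u h⁻¹ * u h = 1 := fun h => by rw [← map_mul]; simp
  have huu' : ∀ h, u h * u h⁻¹ = 1 := fun h => by rw [← map_mul]; simp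
  have hu' : ∀ h (r : R), u h⁻¹ * auxConj ρ R hR h r = r * u h⁻¹ := by
    intro h r
    calc u h⁻¹ * auxConj ρ R hR h r = u h⁻¹ * (auxConj ρ R hR h r * u h) * u h⁻¹ := by
          rw [mul_assoc, mul_assoc, huu', mul_one]
      _ = (u h⁻¹ * u h) * r * u h⁻¹ := by rw [hu]; simp only [mul_assoc]
      _ = _ := by rw [huu, one_mul]
  have hvC : ∀ h, (u h⁻¹ : Module.End (ZMod 2) V) * ρ h ∈ C := by
    intro h
    rw [Subalgebra.mem_centralizer_iff]
    intro r hr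
    have h1 := congrArg Subtype.val (hu' h ⟨r, hr⟩)
    simp only [Subalgebra.coe_mul] at h1
    rw [← mul_assoc, ← h1, mul_assoc, auxConj_mul, mul_assoc]
  let v : H →* C :=
    { toFun := fun h => ⟨(u h⁻¹ : Module.End (ZMod 2) V) * ρ h, hvC h⟩
      map_one' := by ext1; simp
      map_mul' := fun g h => by
        ext1
        have h1 := (hcomm (u h⁻¹) ⟨_, hvC g⟩).eq
        simp only [Subalgebra.coe_val] at h1
        simp only [Subalgebra.coe_mul]
        rw [← mul_assoc, ← h1, mul_inv_rev, map_mul, map_mul]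
        simp only [Subalgebra.coe_mul, mul_assoc] }
  have huv : ∀ h, T (u h ⊗ₜ v h) = ρ h := by
    intro h
    simp only [T, Algebra.TensorProduct.lift_tmul]
    change (u h : Module.End (ZMod 2) V) * ((u h⁻¹ : R) * ρ h) = ρ h
    rw [← mul_assoc, ← Subalgebra.coe_mul, huu']
    simp
  let A : Subalgebra (ZMod 2) R := Algebra.adjoin (ZMod 2) (Set.range u)
  let B : Subalgebra (ZMod 2) C := Algebra.adjoin (ZMod 2) (Set.range v)
  have hge : N * N ≤ Module.finrank (ZMod 2) A * Module.finrank (ZMod 2) B := by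
    have := aux_gen T u v (by simp only [huv]; exact habs)
    rwa [Module.finrank_linearMap, hdim] at this
  have hA : Module.finrank (ZMod 2) A ≤ a * a := by
    rw [← hra]; exact Submodule.finrank_le (Subalgebra.toSubmodule A)
  have hB : Module.finrank (ZMod 2) B ≤ b * b := by
    rw [← hrb]; exact Submodule.finrank_le (Subalgebra.toSubmodule B)
  have hapos : 0 < a * a := by positivity
  have hbpos : 0 < b * b := by positivity
  have hA' : Module.finrank (ZMod 2) A = a * a := by
    by_contra hne
    have hlt := lt_of_le_of_ne hA hne
    have : Module.finrank (ZMod 2) A * Module.finrank (ZMod 2) B < (a * a) * (b * b) :=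
      Nat.mul_lt_mul_of_lt_of_le hlt hB hbpos
    omega
  have hB' : Module.finrank (ZMod 2) B = b * b := by
    by_contra hne
    have hlt := lt_of_le_of_ne hB hne
    have : Module.finrank (ZMod 2) A * Module.finrank (ZMod 2) B < (a * a) * (b * b) :=
      Nat.mul_lt_mul_of_le_of_lt hA hlt hapos
    omega
  have hAtop : A = ⊤ := by
    rw [← Algebra.toSubmodule_eq_top]
    apply Submodule.eq_top_of_finrank_eq
    rw [hra]; exact hA'
  have hBtop : B = ⊤ := by
    rw [← Algebra.toSubmodule_eq_top]
    apply Submodule.eq_top_of_finrank_eq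
    rw [hrb]; exact hB'
  refine ⟨a, b, ?_, hra, ⟨τ, ?_⟩, ⟨(Χ : C →* _).comp v, ?_⟩⟩
  · rw [hA', hB'] at hge
    have : N * N = (a * b) * (a * b) := by
      rw [mul_mul_mul_comm]; exact le_antisymm hge hle
    exact Nat.mul_self_inj.mp this
  · have h1 : Algebra.adjoin (ZMod 2) (Set.range τ) = A.map Φ.toAlgHom := by
      rw [AlgHom.map_adjoin, ← Set.range_comp]
      congr 2
      ext1 h
      simp [u]
    rw [h1, hAtop, Algebra.map_top, AlgHom.range_eq_top]
    exact Φ.surjective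
  · have h1 : Algebra.adjoin (ZMod 2) (Set.range ((Χ : C →* _).comp v)) =
        B.map Χ.toAlgHom := by
      rw [AlgHom.map_adjoin, ← Set.range_comp]
      rfl
    rw [h1, hBtop, Algebra.map_top, AlgHom.range_eq_top]
    exact Χ.surjective

end aux

/-- Criterion for very simplicity of representations over `F₂`: if `H` has no
proper subgroup of index dividing `N`, and for every factorization `N = a·b`
with `a, b > 1` it is not the case that `H` has absolutely simple modules over
`F₂` of both dimensions `a` and `b`, then every absolutely simple `F₂[H]`-module
of dimension `N` is very simple. -/
theorem very_simple_criterion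
    {H : Type*} [Group H] [Finite H] {N : ℕ} (hN : 1 < N)
    (hsub : ∀ K : Subgroup H, K.index ∣ N → K = ⊤)
    (hfact : ∀ a b : ℕ, N = a * b → 1 < a → 1 < b →
      ¬(ExistsAbsSimpleF2ModOfDim H a ∧ ExistsAbsSimpleF2ModOfDim H b))
    (V : Type*) [AddCommGroup V] [Module (ZMod 2) V]
    (ρ : Representation (ZMod 2) H V)
    (hdim : Module.finrank (ZMod 2) V = N)
    (habs : Algebra.adjoin (ZMod 2) (Set.range ρ) = ⊤) :
    VerySimple ρ := by
  intro R hR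
  have : Module.Finite (ZMod 2) V := Module.finite_of_finrank_pos (by omega)
  have : Finite V := Module.finite_of_finite (ZMod 2)
  have : Nontrivial V := Module.nontrivial_of_finrank_pos (R := ZMod 2) (by omega)
  obtain ⟨a, b, hab, hra, hEa, hEb⟩ := aux_main ρ hsub hdim habs R hR
  have ha0 : a ≠ 0 := by rintro rfl; omega
  have hb0 : b ≠ 0 := by rintro rfl; omega
  by_cases ha : a = 1
  · left
    subst ha
    exact Subalgebra.finrank_eq_one_iff.mp hra
  · by_cases hb : b = 1
    · right
      rw [← Algebra.toSubmodule_eq_top]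
      apply Submodule.eq_top_of_finrank_eq
      rw [Module.finrank_linearMap, hdim, hab, hb, mul_one]
      exact hra
    · exact absurd ⟨hEa, hEb⟩ (hfact a b hab (by omega) (by omega))
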